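/- arXiv:1405.4764 — 4 statements merged into one kernel-verified Lean document; each statement's English description precedes it below -/
import Mathlib

section
/- Let Q be an n×n matrix of nonnegative integers, with row sums R_i = ∑_{j=1}^n Q_{i,j} and column sums C_j = ∑_{i=1}^n Q_{i,j}. Then the minimum number L of partial permutation matrices whose (entrywise) sum equals Q satisfies L = max{max_i R_i, max_j C_j}. Equivalently: Q can be written as a sum of L partial permutation matrices if and only if L ≥ max{max_i R_i, max_j C_j}. -/
/-- A partial permutation matrix (schedule): a `{0,1}`-valued matrix with all row
and column sums at most 1. -/
def IsPartialPermMatrix {n : ℕ} (σ : Matrix (Fin n) (Fin n) ℕ) : Prop :=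
  (∀ i j, σ i j ≤ 1) ∧ (∀ i, ∑ j, σ i j ≤ 1) ∧ (∀ j, ∑ i, σ i j ≤ 1)

/-- A natural number matrix with all row and column sums equal to a positive number has a
permutation in its support. -/
theorem exists_perm_pos_of_sum_eq_succ {ι : Type*} [Fintype ι] [DecidableEq ι] {L : ℕ}
    (M : Matrix ι ι ℕ) (hrow : ∀ i, ∑ j, M i j = L + 1) (hcol : ∀ j, ∑ i, M i j = L + 1) :
    ∃ e : Equiv.Perm ι, ∀ i, 0 < M i (e i) := by
  let t : ι → Finset ι := fun i => {j | 0 < M i j}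
  obtain ⟨f, hf, hft⟩ := (Finset.all_card_le_biUnion_card_iff_exists_injective t).1 <| by
    intro s
    refine Nat.le_of_mul_le_mul_right (c := L + 1) ?_ L.succ_pos
    calc s.card * (L + 1) = ∑ i ∈ s, ∑ j, M i j := by simp [hrow]
      _ = ∑ i ∈ s, ∑ j ∈ s.biUnion t, M i j := by
        refine Finset.sum_congr rfl fun i hi => (Finset.sum_subset (Finset.subset_univ _) ?_).symm
        intro j _ hj
        by_contra h
        exact hj (Finset.mem_biUnion.2 ⟨i, hi, by simpa [t] using Nat.pos_of_ne_zero h⟩)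
      _ = ∑ j ∈ s.biUnion t, ∑ i ∈ s, M i j := Finset.sum_comm
      _ ≤ ∑ j ∈ s.biUnion t, ∑ i, M i j :=
        Finset.sum_le_sum fun j _ => Finset.sum_le_sum_of_subset (Finset.subset_univ _)
      _ = (s.biUnion t).card * (L + 1) := by simp [hcol]
  exact ⟨Equiv.ofBijective f (Finite.injective_iff_bijective.1 hf), fun i => by
    simpa [t] using hft i⟩

/-- Integral Birkhoff decomposition: a natural number matrix with all row and column sums equal
to `L` is a sum of `L` permutation matrices. -/
theorem exists_perms_sum_eq_of_sum_eq {ι : Type*} [Fintype ι] [DecidableEq ι] (L : ℕ)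
    (M : Matrix ι ι ℕ) (hrow : ∀ i, ∑ j, M i j = L) (hcol : ∀ j, ∑ i, M i j = L) :
    ∃ e : Fin L → Equiv.Perm ι, ∀ i j, ∑ k, (if e k i = j then 1 else 0) = M i j := by
  induction L generalizing M with
  | zero =>
    refine ⟨Fin.elim0, fun i j => ?_⟩
    simpa using ((Finset.sum_eq_zero_iff.1 (hrow i)) j (Finset.mem_univ j)).symm
  | succ L ih =>
    obtain ⟨p, hp⟩ := exists_perm_pos_of_sum_eq_succ M hrow hcol
    let N : Matrix ι ι ℕ := fun i j => M i j - if p i = j then 1 else 0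
    have hN : ∀ i j, (if p i = j then 1 else 0) + N i j = M i j := by
      intro i j
      refine Nat.add_sub_cancel' ?_
      split_ifs with h
      · exact h ▸ hp i
      · exact Nat.zero_le _
    obtain ⟨e, he⟩ := ih N
      (fun i => by
        have h := hrow i
        simp only [← hN, Finset.sum_add_distrib, Finset.sum_ite_eq, Finset.mem_univ, if_true] at h
        omega)
      (fun j => by
        have h := hcol j
        simp only [← hN, Finset.sum_add_distrib, ← Equiv.eq_symm_apply, Finset.sum_ite_eq',
          Finset.mem_univ, if_true] at h
        omega)
    refine ⟨Fin.cons p e, fun i j => ?_⟩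
    rw [Fin.sum_univ_succ]
    simp only [Fin.cons_zero, Fin.cons_succ, he, hN]

/-- Every top left block of a permutation matrix is a partial permutation matrix. -/
theorem isPartialPermMatrix_of_perm_sum {n : ℕ} {β : Type*} [DecidableEq β]
    (e : Equiv.Perm (Fin n ⊕ β)) :
    IsPartialPermMatrix fun i j => if e (Sum.inl i) = Sum.inl j then 1 else 0 := by
  refine ⟨fun i j => by dsimp only; split_ifs <;> omega, fun i => ?_, fun j => ?_⟩
  · rw [← Finset.card_filter, Finset.card_le_one]
    intro a ha b hb
    simp only [Finset.mem_filter, Finset.mem_univ, true_and] at ha hb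
    exact Sum.inl_injective (ha.symm.trans hb)
  · rw [← Finset.card_filter, Finset.card_le_one]
    intro a ha b hb
    simp only [Finset.mem_filter, Finset.mem_univ, true_and] at ha hb
    exact Sum.inl_injective (e.injective (ha.trans hb.symm))

/-- **Minimum clearance time** (Theorem 4.3): a nonnegative integer matrix `Q` can be
written as an entrywise sum of `L` partial permutation matrices if and only if
`L` is at least the maximum of all row sums and all column sums of `Q`. -/
theorem min_clearance_time (n : ℕ) (Q : Matrix (Fin n) (Fin n) ℕ) (L : ℕ) :
    (∃ σ : Fin L → Matrix (Fin n) (Fin n) ℕ,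
        (∀ k, IsPartialPermMatrix (σ k)) ∧ (∀ i j, ∑ k, σ k i j = Q i j))
      ↔ max (Finset.univ.sup fun i => ∑ j, Q i j)
            (Finset.univ.sup fun j => ∑ i, Q i j) ≤ L := by
  simp only [max_le_iff, Finset.sup_le_iff, Finset.mem_univ, true_implies]
  constructor
  · rintro ⟨σ, hσ, hQ⟩
    simp only [← hQ]
    refine ⟨fun i => ?_, fun j => ?_⟩
    · rw [Finset.sum_comm]
      simpa using Finset.sum_le_sum fun k (_ : k ∈ Finset.univ) => (hσ k).2.1 i
    · rw [Finset.sum_comm]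
      simpa using Finset.sum_le_sum fun k (_ : k ∈ Finset.univ) => (hσ k).2.2 j
  · rintro ⟨hR, hC⟩
    obtain ⟨e, he⟩ := exists_perms_sum_eq_of_sum_eq L
      (Matrix.fromBlocks Q (Matrix.diagonal fun i => L - ∑ j, Q i j)
        (Matrix.diagonal fun j => L - ∑ i, Q i j) Q.transpose)
      (by
        rintro (i | j)
        · simpa [Fintype.sum_sum_type, Matrix.diagonal_apply] using Nat.add_sub_cancel' (hR i)
        · simpa [Fintype.sum_sum_type, Matrix.diagonal_apply] using Nat.sub_add_cancel (hC j))
      (by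
        rintro (j | i)
        · simpa [Fintype.sum_sum_type, Matrix.diagonal_apply] using Nat.add_sub_cancel' (hC j)
        · simpa [Fintype.sum_sum_type, Matrix.diagonal_apply] using Nat.sub_add_cancel (hR i))
    exact ⟨fun k i j => if e k (Sum.inl i) = Sum.inl j then 1 else 0,
      fun k => isPartialPermMatrix_of_perm_sum (e k),
      fun i j => he (Sum.inl i) (Sum.inl j)⟩
end

section
/- Let Q be an n×n matrix of nonnegative integers and let ℓ be a nonnegative integer. If every row sum ∑_{j=1}^n Q_{i,j} and every column sum ∑_{i=1}^n Q_{i,j} of Q is at most ℓ, then Q can be written as an entrywise sum of ℓ partial permutation matrices. -/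
open Finset in
/-- A square matrix of natural numbers whose row and column sums all equal a positive constant
has a permutation supported on its nonzero entries. -/
theorem exists_perm_ne_zero_of_sum_eq {ι : Type*} [Fintype ι] {d : ℕ} (hd : 0 < d)
    (M : Matrix ι ι ℕ) (hrow : ∀ i, ∑ j, M i j = d) (hcol : ∀ j, ∑ i, M i j = d) :
    ∃ π : Equiv.Perm ι, ∀ i, M i (π i) ≠ 0 := by
  classical
  have hall : ∀ S : Finset ι, #S ≤ #(S.biUnion fun i => {j | M i j ≠ 0}) := by
    intro S
    set N := S.biUnion fun i => ({j | M i j ≠ 0} : Finset ι) with hN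
    refine Nat.le_of_mul_le_mul_right ?_ hd
    calc #S * d = ∑ i ∈ S, ∑ j, M i j := by simp [hrow]
      _ = ∑ i ∈ S, ∑ j ∈ N, M i j := by
        refine sum_congr rfl fun i hi => (sum_subset (subset_univ N) fun j _ hj => ?_).symm
        by_contra h
        exact hj (mem_biUnion.2 ⟨i, hi, by simpa using h⟩)
      _ = ∑ j ∈ N, ∑ i ∈ S, M i j := sum_comm
      _ ≤ ∑ j ∈ N, ∑ i, M i j := sum_le_sum fun j _ => sum_le_sum_of_subset (subset_univ S)
      _ = #N * d := by simp [hcol]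
  obtain ⟨f, hf, hfM⟩ := (all_card_le_biUnion_card_iff_exists_injective _).1 hall
  exact ⟨Equiv.ofBijective f (Finite.injective_iff_bijective.1 hf), fun i => by
    simpa using hfM i⟩

/-- A square matrix of natural numbers whose row and column sums all equal `d` is a sum of `d`
permutation matrices. -/
theorem exists_sum_perm_eq_of_sum_eq {ι : Type*} [Fintype ι] [DecidableEq ι] (d : ℕ)
    (M : Matrix ι ι ℕ) (hrow : ∀ i, ∑ j, M i j = d) (hcol : ∀ j, ∑ i, M i j = d) :
    ∃ π : Fin d → Equiv.Perm ι, ∀ i j, ∑ k, (if π k i = j then 1 else 0) = M i j := by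
  induction d generalizing M with
  | zero =>
    refine ⟨Fin.elim0, fun i j => ?_⟩
    have h := Finset.sum_eq_zero_iff.1 (hrow i) j (Finset.mem_univ j)
    simp [h]
  | succ d ih =>
    obtain ⟨p, hp⟩ := exists_perm_ne_zero_of_sum_eq d.succ_pos M hrow hcol
    have hle : ∀ i j, (if p i = j then 1 else 0) ≤ M i j := by
      intro i j
      split_ifs with h
      · exact h ▸ Nat.one_le_iff_ne_zero.2 (hp i)
      · exact Nat.zero_le _
    have hpcol : ∀ j, ∑ i, (if p i = j then 1 else 0) = 1 := by
      intro j
      simp [← Equiv.eq_symm_apply]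
    obtain ⟨π, hπ⟩ := ih (fun i j => M i j - if p i = j then 1 else 0)
      (fun i => by rw [Finset.sum_tsub_distrib _ fun j _ => hle i j, hrow]; simp)
      (fun j => by rw [Finset.sum_tsub_distrib _ fun i _ => hle i j, hcol, hpcol]; simp)
    refine ⟨Fin.cons p π, fun i j => ?_⟩
    rw [Fin.sum_univ_succ]
    simp only [Fin.cons_zero, Fin.cons_succ, hπ]
    exact Nat.add_sub_cancel' (hle i j)

/-- The restriction of a permutation matrix to a square block is a partial permutation matrix. -/
theorem isPartialPermMatrix_of_perm {ι : Type*} [DecidableEq ι] {n : ℕ} (π : Equiv.Perm ι)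
    (f : Fin n ↪ ι) :
    IsPartialPermMatrix (fun i j => if π (f i) = f j then 1 else 0) := by
  refine ⟨fun i j => by dsimp only; split_ifs <;> simp, fun i => ?_, fun j => ?_⟩
  · rw [Finset.sum_boole, Nat.cast_id, Finset.card_le_one]
    intro a ha b hb
    simp only [Finset.mem_filter_univ] at ha hb
    exact f.injective (ha.symm.trans hb)
  · rw [Finset.sum_boole, Nat.cast_id, Finset.card_le_one]
    intro a ha b hb
    simp only [Finset.mem_filter_univ] at ha hb
    exact f.injective (π.injective (ha.trans hb.symm))

/-- If every row sum and every column sum of a nonnegative integer matrix `Q` is at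
most `ℓ`, then `Q` can be written as an entrywise sum of `ℓ` partial permutation
matrices. -/
theorem clearing_in_ell_slots (n ℓ : ℕ) (Q : Matrix (Fin n) (Fin n) ℕ)
    (hrow : ∀ i, ∑ j, Q i j ≤ ℓ) (hcol : ∀ j, ∑ i, Q i j ≤ ℓ) :
    ∃ σ : Fin ℓ → Matrix (Fin n) (Fin n) ℕ,
      (∀ k, IsPartialPermMatrix (σ k)) ∧ (∀ i j, ∑ k, σ k i j = Q i j) := by
  obtain ⟨π, hπ⟩ := exists_sum_perm_eq_of_sum_eq ℓ
    (Matrix.fromBlocks Q (Matrix.diagonal fun i => ℓ - ∑ j, Q i j)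
      (Matrix.diagonal fun j => ℓ - ∑ i, Q i j) Q.transpose)
    (by
      rintro (i | j)
      · simpa [Fintype.sum_sum_type, Matrix.diagonal_apply] using Nat.add_sub_cancel' (hrow i)
      · simpa [Fintype.sum_sum_type, Matrix.diagonal_apply] using Nat.sub_add_cancel (hcol j))
    (by
      rintro (j | i)
      · simpa [Fintype.sum_sum_type, Matrix.diagonal_apply] using Nat.add_sub_cancel' (hcol j)
      · simpa [Fintype.sum_sum_type, Matrix.diagonal_apply] using Nat.sub_add_cancel (hrow i))
  exact ⟨fun k i j => if π k (Sum.inl i) = Sum.inl j then 1 else 0,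
    fun k => isPartialPermMatrix_of_perm (π k) Function.Embedding.inl,
    fun i j => hπ (Sum.inl i) (Sum.inl j)⟩
end

section
/- Let n ≥ 3, f_n ≥ n, ρ = 1 − 1/f_n, b = c_b f_n² log f_n, d = c_d √n f_n log f_n, with constants satisfying c_b > c_s, c_d² ≥ 640 c_b, c_d > c_b, c_s ≥ 30. On some probability space, for each pair (i,j) ∈ {1,...,n}² and each integer t with d ≤ t ≤ b−1, let A_{i,j}(t) be a binomial random variable with parameters t and ρ/n (the cumulative arrivals to queue (i,j) by slot t of an arrival period). Define the event W = ∪_{i,j} ∪_{t=d}^{b−1} {A_{i,j}(t) ≤ (t − d)/n + 1}. Then for all sufficiently large n, P(W) ≤ 1/(2 f_n^{13}). -/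
open MeasureTheory ProbabilityTheory Real

/-- The arrival-period (batch) length `b = c_b f² log f`. -/
noncomputable def batchLen (cb f : ℝ) : ℝ := cb * f ^ 2 * Real.log f

/-- The service-period offset `d = c_d √n f log f`. -/
noncomputable def offsetLen (cd f : ℝ) (n : ℕ) : ℝ :=
  cd * Real.sqrt n * f * Real.log f

lemma exp_neg_le_quadratic {s : ℝ} (hs : 0 ≤ s) : exp (-s) ≤ 1 - s + s ^ 2 / 2 := by
  have h := Real.quadratic_le_exp_of_nonneg hs
  have hq : 0 < 1 - s + s ^ 2 / 2 := by nlinarith [sq_nonneg (s - 1)]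
  rw [Real.exp_neg, inv_le_iff_one_le_mul₀ (Real.exp_pos s)]
  nlinarith [mul_le_mul_of_nonneg_left h hq.le, sq_nonneg (s ^ 2)]

/-- Chernoff bound for the lower tail of the binomial distribution, before optimising in `s`. -/
lemma binomial_lower_tail_le {p s : ℝ} (hp0 : 0 ≤ p) (hp1 : p ≤ 1) (hs : 0 ≤ s) (a : ℝ) (t : ℕ) :
    ∑ k ∈ (Finset.range (t + 1)).filter (fun k : ℕ => (k : ℝ) ≤ a),
        (t.choose k * p ^ k * (1 - p) ^ (t - k) : ℝ)
      ≤ exp (-s * (t * p - a) + t * p * (s ^ 2 / 2)) := by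
  have hq : 0 ≤ 1 - p := sub_nonneg.2 hp1
  calc ∑ k ∈ (Finset.range (t + 1)).filter (fun k : ℕ => (k : ℝ) ≤ a),
        (t.choose k * p ^ k * (1 - p) ^ (t - k) : ℝ)
      ≤ ∑ k ∈ (Finset.range (t + 1)).filter (fun k : ℕ => (k : ℝ) ≤ a),
        exp (s * a) * ((p * exp (-s)) ^ k * (1 - p) ^ (t - k) * t.choose k) := by
        refine Finset.sum_le_sum fun k hk => ?_
        have hka : (k : ℝ) ≤ a := (Finset.mem_filter.1 hk).2
        have h1 : 1 ≤ exp (s * a) * exp (-s) ^ k := by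
          rw [← Real.exp_nat_mul, ← Real.exp_add]
          refine Real.one_le_exp ?_
          nlinarith [mul_le_mul_of_nonneg_left hka hs]
        have h2 : (0 : ℝ) ≤ t.choose k * p ^ k * (1 - p) ^ (t - k) := by positivity
        calc (t.choose k * p ^ k * (1 - p) ^ (t - k) : ℝ)
            ≤ (t.choose k * p ^ k * (1 - p) ^ (t - k)) * (exp (s * a) * exp (-s) ^ k) :=
              le_mul_of_one_le_right h2 h1
          _ = _ := by rw [mul_pow]; ring
    _ ≤ ∑ k ∈ Finset.range (t + 1),
        exp (s * a) * ((p * exp (-s)) ^ k * (1 - p) ^ (t - k) * t.choose k) :=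
        Finset.sum_le_sum_of_subset_of_nonneg (Finset.filter_subset _ _)
          fun _ _ _ => by positivity
    _ = exp (s * a) * (p * exp (-s) + (1 - p)) ^ t := by
        rw [← Finset.mul_sum, ← add_pow]
    _ ≤ exp (s * a) * exp (p * (-s + s ^ 2 / 2)) ^ t := by
        gcongr
        calc p * exp (-s) + (1 - p) ≤ p * (-s + s ^ 2 / 2) + 1 := by
              nlinarith [mul_le_mul_of_nonneg_left (exp_neg_le_quadratic hs) hp0]
          _ ≤ _ := Real.add_one_le_exp _
    _ = _ := by
        rw [← Real.exp_nat_mul, ← Real.exp_add]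
        congr 1
        ring

lemma measure_binomial_le {Ω : Type*} [MeasurableSpace Ω] (P : Measure Ω) (X : Ω → ℕ) {t : ℕ}
    {p s a : ℝ} (hp0 : 0 ≤ p) (hp1 : p ≤ 1) (hs : 0 ≤ s) (hat : a ≤ t)
    (hX : ∀ k : ℕ, P {ω | X ω = k}
      = ENNReal.ofReal (t.choose k * p ^ k * (1 - p) ^ (t - k))) :
    P {ω | (X ω : ℝ) ≤ a} ≤ ENNReal.ofReal (exp (-s * (t * p - a) + t * p * (s ^ 2 / 2))) := by
  have hq : 0 ≤ 1 - p := sub_nonneg.2 hp1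
  have hsub : {ω | (X ω : ℝ) ≤ a} ⊆
      ⋃ k ∈ (Finset.range (t + 1)).filter (fun k : ℕ => (k : ℝ) ≤ a), {ω | X ω = k} := by
    intro ω hω
    have hω' : (X ω : ℝ) ≤ a := hω
    have hXt : X ω ≤ t := by exact_mod_cast hω'.trans hat
    simp only [Set.mem_iUnion]
    exact ⟨X ω, by simp [hXt, hω'], rfl⟩
  calc P {ω | (X ω : ℝ) ≤ a}
      ≤ ∑ k ∈ (Finset.range (t + 1)).filter (fun k : ℕ => (k : ℝ) ≤ a), P {ω | X ω = k} :=
        (measure_mono hsub).trans (measure_biUnion_finset_le _ _)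
    _ = ENNReal.ofReal (∑ k ∈ (Finset.range (t + 1)).filter (fun k : ℕ => (k : ℝ) ≤ a),
          (t.choose k * p ^ k * (1 - p) ^ (t - k) : ℝ)) := by
        rw [ENNReal.ofReal_sum_of_nonneg fun _ _ => by positivity]
        exact Finset.sum_congr rfl fun k _ => hX k
    _ ≤ _ := ENNReal.ofReal_le_ofReal (binomial_lower_tail_le hp0 hp1 hs a t)

/-- The mean number of arrivals exceeds the threshold by at least half of `d / n`. -/
lemma half_offset_le_mean_sub_threshold {cb cd F t : ℝ} {n : ℕ} (hn : 9 ≤ n) (hnF : (n : ℝ) ≤ F)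
    (hcd : 30 ≤ cd) (hbd : cb ≤ cd) (ht : t ≤ batchLen cb F) :
    offsetLen cd F n / (2 * n)
      ≤ t * ((1 - 1 / F) / n) - ((t - offsetLen cd F n) / n + 1) := by
  have hn' : (9 : ℝ) ≤ n := by exact_mod_cast hn
  have hF : 0 < F := by linarith
  have hlog : 1 ≤ log F := by
    rw [Real.le_log_iff_exp_le hF]
    linarith [Real.exp_one_lt_d9]
  have hsqrt : 3 ≤ √(n : ℝ) := Real.le_sqrt_of_sq_le (by linarith)
  have hFL : F ≤ F * log F := le_mul_of_one_le_right hF.le hlog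
  have htF : t / F ≤ cd * (F * log F) := by
    rw [div_le_iff₀ hF]
    unfold batchLen at ht
    have h : cb * (F ^ 2 * log F) ≤ cd * (F ^ 2 * log F) := by gcongr
    nlinarith
  have key : t / F + n ≤ offsetLen cd F n / 2 := by
    have e : offsetLen cd F n = √(n : ℝ) * (cd * (F * log F)) := by unfold offsetLen; ring
    have h30 : 30 * (F * log F) ≤ cd * (F * log F) := by gcongr
    rw [e]
    nlinarith [mul_le_mul_of_nonneg_right hsqrt (by positivity : 0 ≤ cd * (F * log F))]
  have hn0 : (0 : ℝ) < n := by linarith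
  have e : t * ((1 - 1 / F) / n) - ((t - offsetLen cd F n) / n + 1)
      = (offsetLen cd F n - (t / F + n)) / n := by
    field_simp
    ring
  rw [e, ← div_div]
  gcongr
  linarith

/-- The optimised Chernoff exponent is at most `-80 log f`. -/
lemma chernoff_exponent_le {cb cd F δ μ : ℝ} {n : ℕ} (hn : 9 ≤ n) (hnF : (n : ℝ) ≤ F)
    (hcb : 0 < cb) (hcd : 0 < cd) (h : 640 * cb ≤ cd ^ 2)
    (hδ : offsetLen cd F n / (2 * n) ≤ δ) (hμ : μ ≤ batchLen cb F / n) :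
    -(offsetLen cd F n / (2 * batchLen cb F)) * δ
      + μ * ((offsetLen cd F n / (2 * batchLen cb F)) ^ 2 / 2) ≤ -(80 * log F) := by
  have hn' : (9 : ℝ) ≤ n := by exact_mod_cast hn
  have hn0 : (0 : ℝ) < n := by linarith
  have hF : 0 < F := by linarith
  have hlog : 0 < log F := Real.log_pos (by linarith)
  have hb : 0 < batchLen cb F := by unfold batchLen; positivity
  have hd : 0 < offsetLen cd F n := by unfold offsetLen; positivity
  set s := offsetLen cd F n / (2 * batchLen cb F) with hs
  have hs0 : 0 < s := by positivity
  have hsq : √(n : ℝ) ^ 2 = n := Real.sq_sqrt hn0.le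
  have hval : -s * (offsetLen cd F n / (2 * n)) + batchLen cb F / n * (s ^ 2 / 2)
      = -(cd ^ 2 / (8 * cb) * log F) := by
    have e1 : -s * (offsetLen cd F n / (2 * n)) + batchLen cb F / n * (s ^ 2 / 2)
        = -(offsetLen cd F n ^ 2 / (8 * n * batchLen cb F)) := by
      rw [hs]
      field_simp
      ring
    have e2 : offsetLen cd F n ^ 2 = n * (cd ^ 2 * F ^ 2 * log F ^ 2) := by
      unfold offsetLen
      rw [← hsq]
      ring_nf
      simp
    rw [e1, e2]
    unfold batchLen
    field_simp
  have h80 : 80 ≤ cd ^ 2 / (8 * cb) := by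
    rw [le_div_iff₀ (by positivity)]
    linarith
  have hA : s * (offsetLen cd F n / (2 * n)) ≤ s * δ := by gcongr
  have hB : μ * (s ^ 2 / 2) ≤ batchLen cb F / n * (s ^ 2 / 2) := by gcongr
  have hC : 80 * log F ≤ cd ^ 2 / (8 * cb) * log F := by gcongr
  linarith

lemma union_bound_count_le {cb F : ℝ} {n : ℕ} (hn : 9 ≤ n) (hnF : (n : ℝ) ≤ F)
    (hcb : 0 < cb) (hcbn : cb ≤ n) :
    (n : ℝ) * (n * (⌊batchLen cb F⌋₊ * exp (-(80 * log F)))) ≤ 1 / (2 * F ^ (13 : ℕ)) := by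
  have hn' : (9 : ℝ) ≤ n := by exact_mod_cast hn
  have hF : 0 < F := by linarith
  have hF1 : 1 ≤ F := by linarith
  have hlog : 0 ≤ log F := Real.log_nonneg hF1
  have hexp : exp (-(80 * log F)) = (F ^ 80)⁻¹ := by
    rw [Real.exp_neg]
    have := Real.exp_nat_mul (log F) 80
    rw [Real.exp_log hF] at this
    rw [← this]
    norm_num
  have hb : (⌊batchLen cb F⌋₊ : ℝ) ≤ F ^ 4 := by
    refine (Nat.floor_le (by unfold batchLen; positivity)).trans ?_
    calc cb * F ^ 2 * log F ≤ F * F ^ 2 * F := by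
          gcongr
          · exact hcbn.trans hnF
          · linarith [Real.log_le_sub_one_of_pos hF]
      _ = F ^ 4 := by ring
  rw [hexp]
  calc (n : ℝ) * (n * (⌊batchLen cb F⌋₊ * (F ^ 80)⁻¹)) ≤ F * (F * (F ^ 4 * (F ^ 80)⁻¹)) := by
        gcongr
    _ = 1 / (F ^ 61 * F ^ 13) := by field_simp
    _ ≤ 1 / (2 * F ^ 13) := by
        gcongr
        exact (by linarith : (2 : ℝ) ≤ F).trans (le_self_pow₀ hF1 (by norm_num))

/-- Lemma 6.2: let `ρ = 1 - 1/f_n` and, for each pair `(i,j)` and each integer `t`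
with `d ≤ t ≤ b - 1`, let `A i j t` be a binomial random variable with parameters
`t` and `ρ/n` (the cumulative arrivals to queue `(i,j)` by slot `t` of an arrival
period).  With `W = ∪_{i,j} ∪_{t=d}^{b-1} {A i j t ≤ (t - d)/n + 1}`, for all
sufficiently large `n` we have `P(W) ≤ 1/(2 f_n¹³)`. -/
theorem no_waste_event_bound (f : ℕ → ℝ) (hf : ∀ n : ℕ, (n : ℝ) ≤ f n)
    (cb cd cs : ℝ) (hcb : 0 < cb) (hcd : 0 < cd) (hcs0 : 0 < cs)
    (h1 : cs < cb) (h2 : 640 * cb ≤ cd ^ 2) (h3 : cb < cd) (h4 : 30 ≤ cs) :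
    ∃ N : ℕ, ∀ n : ℕ, N ≤ n →
    ∀ (Ω : Type) (mΩ : MeasurableSpace Ω) (P : Measure Ω), IsProbabilityMeasure P →
    ∀ A : Fin n → Fin n → ℕ → Ω → ℕ,
    (∀ i j t, Measurable (A i j t)) →
    (∀ (i j : Fin n) (t k : ℕ),
        offsetLen cd (f n) n ≤ (t : ℝ) → (t : ℝ) ≤ batchLen cb (f n) - 1 →
        P {ω | A i j t ω = k}
          = ENNReal.ofReal (t.choose k * ((1 - 1 / f n) / n) ^ k
              * (1 - (1 - 1 / f n) / n) ^ (t - k))) →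
    P (⋃ i, ⋃ j, ⋃ t : ℕ,
        ⋃ (_ : offsetLen cd (f n) n ≤ (t : ℝ) ∧ (t : ℝ) ≤ batchLen cb (f n) - 1),
        {ω | (A i j t ω : ℝ) ≤ ((t : ℝ) - offsetLen cd (f n) n) / n + 1})
      ≤ ENNReal.ofReal (1 / (2 * f n ^ (13 : ℕ))) := by
  refine ⟨max 9 ⌈cb⌉₊, fun n hN Ω mΩ P _ A _ hA => ?_⟩
  have hn : 9 ≤ n := (le_max_left _ _).trans hN
  have hcbn : cb ≤ n := Nat.ceil_le.1 ((le_max_right _ _).trans hN)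
  have hnF : (n : ℝ) ≤ f n := hf n
  have hn' : (9 : ℝ) ≤ n := by exact_mod_cast hn
  have hn0 : (0 : ℝ) < n := by linarith
  have hF1 : 1 ≤ f n := by linarith
  have hF : 0 < f n := by linarith
  have hlog : 0 < log (f n) := Real.log_pos (by linarith)
  have hb : 0 < batchLen cb (f n) := by unfold batchLen; positivity
  have hd : 0 < offsetLen cd (f n) n := by unfold offsetLen; positivity
  set p : ℝ := (1 - 1 / f n) / n with hp
  have hρ0 : 0 ≤ 1 - 1 / f n := sub_nonneg.2 ((div_le_one hF).2 hF1)
  have hρ1 : 1 - 1 / f n ≤ 1 := sub_le_self _ (by positivity)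
  have hp0 : 0 ≤ p := by positivity
  have hpn : p ≤ 1 / n := by rw [hp]; gcongr
  have hp1 : p ≤ 1 := hpn.trans ((div_le_one hn0).2 (by linarith))
  have tail : ∀ (i j : Fin n) (t : ℕ), offsetLen cd (f n) n ≤ (t : ℝ) →
      (t : ℝ) ≤ batchLen cb (f n) - 1 →
      P {ω | (A i j t ω : ℝ) ≤ ((t : ℝ) - offsetLen cd (f n) n) / n + 1}
        ≤ ENNReal.ofReal (exp (-(80 * log (f n)))) := by
    intro i j t htd htb
    have hδ := half_offset_le_mean_sub_threshold (cb := cb) (cd := cd) (t := t) hn hnF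
      (by linarith) h3.le (by linarith)
    rw [← hp] at hδ
    have hμ : t * p ≤ batchLen cb (f n) / n := by
      calc t * p ≤ batchLen cb (f n) * (1 / n) := by gcongr; linarith
        _ = _ := by ring
    have hat : ((t : ℝ) - offsetLen cd (f n) n) / n + 1 ≤ t := by
      have h₁ : 0 ≤ offsetLen cd (f n) n / (2 * n) := by positivity
      have h₂ : (t : ℝ) * p ≤ t := mul_le_of_le_one_right (Nat.cast_nonneg t) hp1
      linarith
    refine (measure_binomial_le P (A i j t) (s := offsetLen cd (f n) n / (2 * batchLen cb (f n)))
      hp0 hp1 (by positivity) hat fun k => hA i j t k htd htb).trans ?_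
    gcongr
    exact chernoff_exponent_le hn hnF hcb hcd h2 hδ hμ
  have times : ∀ i j : Fin n,
      P (⋃ t : ℕ, ⋃ (_ : offsetLen cd (f n) n ≤ (t : ℝ) ∧ (t : ℝ) ≤ batchLen cb (f n) - 1),
        {ω | (A i j t ω : ℝ) ≤ ((t : ℝ) - offsetLen cd (f n) n) / n + 1})
      ≤ ENNReal.ofReal (⌊batchLen cb (f n)⌋₊ * exp (-(80 * log (f n)))) := by
    intro i j
    have hsub : (⋃ t : ℕ,
        ⋃ (_ : offsetLen cd (f n) n ≤ (t : ℝ) ∧ (t : ℝ) ≤ batchLen cb (f n) - 1),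
        {ω | (A i j t ω : ℝ) ≤ ((t : ℝ) - offsetLen cd (f n) n) / n + 1})
        ⊆ ⋃ t ∈ Finset.range ⌊batchLen cb (f n)⌋₊,
          ⋃ (_ : offsetLen cd (f n) n ≤ (t : ℝ) ∧ (t : ℝ) ≤ batchLen cb (f n) - 1),
          {ω | (A i j t ω : ℝ) ≤ ((t : ℝ) - offsetLen cd (f n) n) / n + 1} := by
      refine Set.iUnion_subset fun t => Set.iUnion_subset fun ht => ?_
      have hmem : t ∈ Finset.range ⌊batchLen cb (f n)⌋₊ := by
        rw [Finset.mem_range, ← Nat.succ_le_iff]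
        refine Nat.le_floor ?_
        push_cast
        linarith [ht.2]
      intro ω hω
      simp only [Set.mem_iUnion]
      exact ⟨t, hmem, ht, hω⟩
    refine (measure_mono hsub).trans ((measure_biUnion_finset_le _ _).trans ?_)
    calc _ ≤ ∑ _t ∈ Finset.range ⌊batchLen cb (f n)⌋₊,
          ENNReal.ofReal (exp (-(80 * log (f n)))) := by
          refine Finset.sum_le_sum fun t _ => ?_
          by_cases ht : offsetLen cd (f n) n ≤ (t : ℝ) ∧ (t : ℝ) ≤ batchLen cb (f n) - 1
          · simpa only [ht, and_self, Set.iUnion_true] using tail i j t ht.1 ht.2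
          · simp [ht]
      _ = _ := by
          rw [Finset.sum_const, Finset.card_range, nsmul_eq_mul,
            ENNReal.ofReal_mul (Nat.cast_nonneg _), ENNReal.ofReal_natCast]
  calc _ ≤ ∑ _i : Fin n, ∑ _j : Fin n,
        ENNReal.ofReal (⌊batchLen cb (f n)⌋₊ * exp (-(80 * log (f n)))) :=
        (measure_iUnion_fintype_le _ _).trans <| Finset.sum_le_sum fun i _ =>
          (measure_iUnion_fintype_le _ _).trans <| Finset.sum_le_sum fun j _ => times i j
    _ = ENNReal.ofReal (n * (n * (⌊batchLen cb (f n)⌋₊ * exp (-(80 * log (f n)))))) := by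
        simp only [Finset.sum_const, Finset.card_univ, Fintype.card_fin, nsmul_eq_mul]
        rw [ENNReal.ofReal_mul (Nat.cast_nonneg n), ENNReal.ofReal_mul (Nat.cast_nonneg n),
          ENNReal.ofReal_natCast]
    _ ≤ _ := ENNReal.ofReal_le_ofReal (union_bound_count_le hn hnF hcb hcbn)
end

section
/- Let n ≥ 3, f_n ≥ n, ρ = 1 − 1/f_n, b = c_b f_n² log f_n, s = ρb + √(c_s b log f_n), with constants satisfying c_b > c_s, c_d² ≥ 640 c_b, c_d > c_b, c_s ≥ 30. On some probability space, let R_1,...,R_n and C_1,...,C_n each be binomial random variables with parameters nb and ρ/n (the row and column sums of the batch arrival matrix). Define H = (∪_{i=1}^n {R_i > s}) ∪ (∪_{j=1}^n {C_j > s}). Then for all sufficiently large n, P(H) ≤ 1/(2 f_n^{13}). -/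
open MeasureTheory ProbabilityTheory Real

/-- `s = ρ b + √(c_s b log f)`, where `ρ = 1 - 1/f`. -/
noncomputable def sLen (cb cs f : ℝ) : ℝ :=
  (1 - 1 / f) * batchLen cb f + Real.sqrt (cs * batchLen cb f * Real.log f)

open Finset in
/-- Chernoff bound for the upper tail of a binomial random variable. -/
theorem binomial_upper_tail_le {Ω : Type*} [MeasurableSpace Ω] (P : Measure Ω) (m : ℕ) {p : ℝ}
    (hp0 : 0 ≤ p) (hp1 : p ≤ 1) (X : Ω → ℕ)
    (hX : ∀ k : ℕ, P {ω | X ω = k} = ENNReal.ofReal (m.choose k * p ^ k * (1 - p) ^ (m - k)))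
    (s : ℝ) {θ : ℝ} (hθ : 0 ≤ θ) :
    P {ω | s < (X ω : ℝ)} ≤ ENNReal.ofReal (exp (m * p * (exp θ - 1) - θ * s)) := by
  have hq : 0 ≤ 1 - p := sub_nonneg.mpr hp1
  have hterm : ∀ k : ℕ, P {ω | X ω = k ∧ s < (k : ℝ)} ≤
      ENNReal.ofReal (m.choose k * p ^ k * (1 - p) ^ (m - k) * exp (θ * (k - s))) := by
    intro k
    by_cases hk : s < (k : ℝ)
    · simp only [hk, and_true, hX]
      apply ENNReal.ofReal_le_ofReal
      exact le_mul_of_one_le_right (by positivity)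
        (one_le_exp (mul_nonneg hθ (sub_nonneg.mpr hk.le)))
    · simp [hk]
  calc P {ω | s < (X ω : ℝ)}
      ≤ P (⋃ k : ℕ, {ω | X ω = k ∧ s < (k : ℝ)}) :=
        measure_mono fun ω hω => Set.mem_iUnion.mpr ⟨X ω, rfl, hω⟩
    _ ≤ ∑' k : ℕ, P {ω | X ω = k ∧ s < (k : ℝ)} := measure_iUnion_le _
    _ ≤ ∑' k : ℕ, ENNReal.ofReal
          (m.choose k * p ^ k * (1 - p) ^ (m - k) * exp (θ * (k - s))) :=
        ENNReal.tsum_le_tsum hterm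
    _ = ∑ k ∈ range (m + 1), ENNReal.ofReal
          (m.choose k * p ^ k * (1 - p) ^ (m - k) * exp (θ * (k - s))) := by
        refine tsum_eq_sum fun k hk => ?_
        have hmk : m < k := by simpa using hk
        simp [Nat.choose_eq_zero_of_lt hmk]
    _ = ENNReal.ofReal (∑ k ∈ range (m + 1),
          m.choose k * p ^ k * (1 - p) ^ (m - k) * exp (θ * (k - s))) :=
        (ENNReal.ofReal_sum_of_nonneg fun k _ => by positivity).symm
    _ = ENNReal.ofReal ((p * exp θ + (1 - p)) ^ m * exp (-(θ * s))) := by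
        rw [add_pow, sum_mul]
        congr 1
        refine sum_congr rfl fun k _ => ?_
        rw [show θ * ((k : ℝ) - s) = k * θ + -(θ * s) by ring, exp_add, exp_nat_mul, mul_pow]
        ring
    _ ≤ ENNReal.ofReal (exp (m * p * (exp θ - 1) - θ * s)) := by
        apply ENNReal.ofReal_le_ofReal
        rw [show m * p * (exp θ - 1) - θ * s = m * (p * (exp θ - 1)) + -(θ * s) by ring,
          exp_add, exp_nat_mul]
        gcongr
        linarith [add_one_le_exp (p * (exp θ - 1))]

theorem exp_le_one_add_add_sq_mul {θ : ℝ} (h0 : 0 ≤ θ) (h1 : θ ≤ 1) :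
    exp θ ≤ 1 + θ + θ ^ 2 / 2 * (1 + θ) := by
  have h := exp_bound' h0 h1 (n := 3) (by norm_num)
  norm_num [Finset.sum_range_succ, Nat.factorial] at h
  nlinarith [pow_nonneg h0 3]

/-- The Chernoff exponent at `θ = √(c_s b log f) / b`. -/
theorem chernoff_exponent_le_s11 {cb cs f : ℝ} (hcb : 0 < cb) (hcs : 30 ≤ cs) (h : cs < cb)
    (hf : 1 < f) :
    ∃ θ : ℝ, 0 ≤ θ ∧ (1 - 1 / f) * batchLen cb f * (exp θ - 1) - θ * sLen cb cs f
      ≤ -15 * log f := by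
  have hL : 0 < log f := log_pos hf
  have hf0 : 0 < f := by linarith
  have hb : 0 < batchLen cb f := by unfold batchLen; positivity
  have hbL : log f = batchLen cb f / (cb * f ^ 2) := by unfold batchLen; field_simp
  unfold sLen
  generalize batchLen cb f = b at *
  set t := √(cs * b * log f) with ht
  have ht2 : t ^ 2 = cs * b * log f := sq_sqrt (by positivity)
  have ht0 : 0 ≤ t := sqrt_nonneg _
  have htb : t / b ≤ 1 / f := by
    apply le_of_sq_le_sq _ (by positivity)
    rw [div_pow, ht2, hbL, div_pow, one_pow, div_le_div_iff₀ (by positivity) (by positivity)]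
    have : cs * b * (b / (cb * f ^ 2)) * f ^ 2 = cs / cb * b ^ 2 := by field_simp
    rw [this]
    gcongr
    exact (div_le_one hcb).mpr h.le
  have hf1 : 1 / f ≤ 1 := (div_le_one hf0).mpr hf.le
  have htt : t = b * (t / b) := by field_simp
  have hbθ : b * (t / b) ^ 2 = cs * log f := by
    rw [div_pow, ht2]; field_simp
  refine ⟨t / b, by positivity, ?_⟩
  generalize t / b = θ at *
  have hθ0 : 0 ≤ θ := by
    by_contra hneg
    push Not at hneg
    nlinarith
  have hexp := exp_le_one_add_add_sq_mul hθ0 (htb.trans hf1)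
  have h1 : (1 - 1 / f) * b * (exp θ - 1 - θ) ≤ (1 - 1 / f) * b * (θ ^ 2 / 2 * (1 + θ)) := by
    have : 0 ≤ 1 - 1 / f := by linarith
    gcongr
    linarith
  have h2 : (1 - 1 / f) * (1 + θ) ≤ 1 := by
    have : (1 - 1 / f) * (1 + θ) ≤ (1 - 1 / f) * (1 + 1 / f) := by
      have : 0 ≤ 1 - 1 / f := by linarith
      gcongr
    nlinarith [sq_nonneg (1 / f)]
  have h3 : b * θ ^ 2 / 2 * ((1 - 1 / f) * (1 + θ)) ≤ b * θ ^ 2 / 2 * 1 := by gcongr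
  have h4 : 30 * log f ≤ cs * log f := by gcongr
  have h5 : θ * t = b * θ ^ 2 := by rw [htt]; ring
  nlinarith

/-- Lemma 6.3: let `ρ = 1 - 1/f_n` and let `R₁, …, R_n, C₁, …, C_n` be binomial
random variables with parameters `nb` and `ρ/n` (the row and column sums of the
batch arrival matrix).  With `H = (∪ᵢ {Rᵢ > s}) ∪ (∪ⱼ {Cⱼ > s})`, for all
sufficiently large `n` we have `P(H) ≤ 1/(2 f_n¹³)`. -/
theorem no_large_port_sum (f : ℕ → ℝ) (hf : ∀ n : ℕ, (n : ℝ) ≤ f n)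
    (cb cd cs : ℝ) (hcb : 0 < cb) (hcd : 0 < cd) (hcs0 : 0 < cs)
    (h1 : cs < cb) (h2 : 640 * cb ≤ cd ^ 2) (h3 : cb < cd) (h4 : 30 ≤ cs) :
    ∃ N : ℕ, ∀ n : ℕ, N ≤ n →
    ∀ (Ω : Type) (mΩ : MeasurableSpace Ω) (P : Measure Ω), IsProbabilityMeasure P →
    ∀ m : ℕ, (m : ℝ) = n * batchLen cb (f n) →
    ∀ R C : Fin n → Ω → ℕ, (∀ i, Measurable (R i)) → (∀ j, Measurable (C j)) →
    (∀ (i : Fin n) (k : ℕ), P {ω | R i ω = k}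
        = ENNReal.ofReal (m.choose k * ((1 - 1 / f n) / n) ^ k
            * (1 - (1 - 1 / f n) / n) ^ (m - k))) →
    (∀ (j : Fin n) (k : ℕ), P {ω | C j ω = k}
        = ENNReal.ofReal (m.choose k * ((1 - 1 / f n) / n) ^ k
            * (1 - (1 - 1 / f n) / n) ^ (m - k))) →
    P ((⋃ i, {ω | sLen cb cs (f n) < (R i ω : ℝ)})
        ∪ ⋃ j, {ω | sLen cb cs (f n) < (C j ω : ℝ)})
      ≤ ENNReal.ofReal (1 / (2 * f n ^ (13 : ℕ))) := by
  refine ⟨4, fun n hn Ω mΩ P _ m hm R C _ _ hR hC => ?_⟩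
  have hn4 : (4 : ℝ) ≤ n := by exact_mod_cast hn
  have hfn := hf n
  generalize f n = F at *
  have hF : 4 ≤ F := hn4.trans hfn
  have hF0 : 0 < F := by linarith
  have hn0 : (0 : ℝ) < n := by linarith
  have hρ0 : 0 ≤ 1 - 1 / F := sub_nonneg.mpr ((div_le_one hF0).mpr (by linarith))
  have hρ1 : 1 - 1 / F ≤ 1 := sub_le_self _ (by positivity)
  have hp0 : 0 ≤ (1 - 1 / F) / n := by positivity
  have hp1 : (1 - 1 / F) / n ≤ 1 := (div_le_one hn0).mpr (by linarith)
  obtain ⟨θ, hθ, hexp⟩ := chernoff_exponent_le_s11 hcb h4 h1 (show 1 < F by linarith)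
  have hmp : m * ((1 - 1 / F) / n) = (1 - 1 / F) * batchLen cb F := by
    rw [hm]; field_simp
  have htail : ∀ X : Ω → ℕ, (∀ k : ℕ, P {ω | X ω = k}
      = ENNReal.ofReal (m.choose k * ((1 - 1 / F) / n) ^ k
          * (1 - (1 - 1 / F) / n) ^ (m - k))) →
      P {ω | sLen cb cs F < (X ω : ℝ)} ≤ ENNReal.ofReal (1 / F ^ 15) := by
    intro X hX
    refine (binomial_upper_tail_le P m hp0 hp1 X hX _ hθ).trans (ENNReal.ofReal_le_ofReal ?_)
    rw [hmp]
    refine (exp_le_exp.mpr hexp).trans_eq ?_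
    rw [neg_mul, exp_neg, show (15 : ℝ) * log F = (15 : ℕ) * log F by norm_num, exp_nat_mul,
      exp_log hF0, one_div]
  have hunion : ∀ X : Fin n → Ω → ℕ, (∀ (i : Fin n) (k : ℕ), P {ω | X i ω = k}
      = ENNReal.ofReal (m.choose k * ((1 - 1 / F) / n) ^ k
          * (1 - (1 - 1 / F) / n) ^ (m - k))) →
      P (⋃ i, {ω | sLen cb cs F < (X i ω : ℝ)}) ≤ ENNReal.ofReal (n * (1 / F ^ 15)) := by
    intro X hX
    calc P (⋃ i, {ω | sLen cb cs F < (X i ω : ℝ)})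
        ≤ ∑ i, P {ω | sLen cb cs F < (X i ω : ℝ)} := measure_iUnion_fintype_le _ _
      _ ≤ ∑ _i : Fin n, ENNReal.ofReal (1 / F ^ 15) :=
          Finset.sum_le_sum fun i _ => htail (X i) (hX i)
      _ = ENNReal.ofReal (n * (1 / F ^ 15)) := by
          rw [ENNReal.ofReal_mul hn0.le]
          simp
  refine (measure_union_le _ _).trans ((add_le_add (hunion R hR) (hunion C hC)).trans ?_)
  rw [← ENNReal.ofReal_add (by positivity) (by positivity)]
  apply ENNReal.ofReal_le_ofReal
  calc n * (1 / F ^ 15) + n * (1 / F ^ 15) = 2 * n / F ^ 15 := by ring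
    _ ≤ 2 * F / F ^ 15 := by gcongr
    _ = 4 / (F * (2 * F ^ 13)) := by field_simp; norm_num
    _ ≤ F / (F * (2 * F ^ 13)) := by gcongr
    _ = 1 / (2 * F ^ 13) := by field_simp
end
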